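/- Let n ≥ 1, let f_1, …, f_n : ℝ^d → ℝ be differentiable convex functions whose gradients are L-Lipschitz (L > 0), let f = (1/n)∑_{i=1}^n f_i, and let x* be a global minimizer of f. Let x, w ∈ ℝ^d, let θ ∈ (0, 1), and let η > 0 satisfy η ≤ 1/( L·(1 + 1/(1 − θ)) ). Define u = θx + (1 − θ)w, and for each i ∈ {1,…,n} define g_i = ∇f_i(u) − ∇f_i(w) + ∇f(w), x⁺_i = x − (η/θ)·g_i, and b_i = θ·x⁺_i + (1 − θ)·w. Then (1/n)∑_{i=1}^n f(b_i) ≤ (1 − θ)·f(w) + θ·f(x*) + (θ²/(2η))·( ‖x − x*‖² − (1/n)∑_{i=1}^n ‖x⁺_i − x*‖² ) + (L(1 − θ)θ²/2)·‖x − w‖². -/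

import Mathlib

open scoped RealInnerProductSpace

section Smooth

variable {E : Type*} [NormedAddCommGroup E] [InnerProductSpace ℝ E] [CompleteSpace E]

theorem hasDerivAt_comp_add_smul_gradient {f : E → ℝ} (hf : Differentiable ℝ f) (x v : E) (t : ℝ) :
    HasDerivAt (fun s : ℝ => f (x + s • v)) ⟪gradient f (x + t • v), v⟫ t := by
  have h : HasDerivAt (fun s : ℝ => x + s • v) v t := by
    simpa using ((hasDerivAt_id t).smul_const v).const_add x
  rw [inner_gradient_left]
  exact (hf (x + t • v)).hasFDerivAt.comp_hasDerivAt t h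

/-- The descent lemma for functions with Lipschitz gradient. -/
theorem le_add_inner_gradient_add_of_lipschitz {f : E → ℝ} {L : ℝ} (hf : Differentiable ℝ f)
    (hlip : ∀ x y, ‖gradient f x - gradient f y‖ ≤ L * ‖x - y‖) (x y : E) :
    f y ≤ f x + ⟪gradient f x, y - x⟫ + L / 2 * ‖y - x‖ ^ 2 := by
  set v := y - x with hv
  have hd := hasDerivAt_comp_add_smul_gradient hf x v
  have hB : ∀ t : ℝ, HasDerivAt
      (fun s : ℝ => f x + s * ⟪gradient f x, v⟫ + s ^ 2 * (L / 2 * ‖v‖ ^ 2))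
      (⟪gradient f x, v⟫ + t * (L * ‖v‖ ^ 2)) t := by
    intro t
    have h := (((hasDerivAt_id t).mul_const ⟪gradient f x, v⟫).const_add (f x)).add
      ((hasDerivAt_pow 2 t).mul_const (L / 2 * ‖v‖ ^ 2))
    refine h.congr_deriv ?_
    push_cast
    ring
  have key := image_le_of_deriv_right_le_deriv_boundary (a := 0) (b := 1)
    (fun t _ => (hd t).continuousAt.continuousWithinAt) (fun t _ => (hd t).hasDerivWithinAt)
    (by simp) (fun t _ => (hB t).continuousAt.continuousWithinAt)
    (fun t _ => (hB t).hasDerivWithinAt) (fun t ht => by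
      have h1 : ⟪gradient f (x + t • v) - gradient f x, v⟫ ≤ L * ‖t • v‖ * ‖v‖ := by
        refine (real_inner_le_norm _ _).trans ?_
        gcongr
        simpa using hlip (x + t • v) x
      rw [norm_smul, Real.norm_of_nonneg ht.1, inner_sub_left] at h1
      linarith) (Set.right_mem_Icc.2 zero_le_one)
  simpa [hv] using key

theorem ConvexOn.add_inner_gradient_le {f : E → ℝ} (hf : Differentiable ℝ f)
    (hc : ConvexOn ℝ Set.univ f) (x y : E) :
    f x + ⟪gradient f x, y - x⟫ ≤ f y := by
  have hd := hasDerivAt_comp_add_smul_gradient hf x (y - x) 0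
  have hline : ConvexOn ℝ Set.univ (fun s : ℝ => f (x + s • (y - x))) := by
    have h := hc.comp_affineMap (AffineMap.lineMap (k := ℝ) x y)
    have heq : f ∘ AffineMap.lineMap (k := ℝ) x y = fun s : ℝ => f (x + s • (y - x)) := by
      ext s
      simp [AffineMap.lineMap_apply, add_comm]
    rwa [Set.preimage_univ, heq] at h
  have h := hline.le_slope_of_hasDerivAt (Set.mem_univ 0) (Set.mem_univ 1) zero_lt_one hd
  simp only [slope_def_field, one_smul, zero_smul, add_zero, add_sub_cancel, sub_zero,
    div_one] at h
  linarith

/-- Cocoercivity: the Bregman divergence of a smooth convex function dominates the squared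
difference of its gradients. -/
theorem ConvexOn.norm_gradient_sub_sq_le {f : E → ℝ} {L : ℝ} (hL : 0 < L)
    (hf : Differentiable ℝ f) (hc : ConvexOn ℝ Set.univ f)
    (hlip : ∀ x y, ‖gradient f x - gradient f y‖ ≤ L * ‖x - y‖) (x y : E) :
    ‖gradient f x - gradient f y‖ ^ 2 ≤ 2 * L * (f y - f x - ⟪gradient f x, y - x⟫) := by
  set δ := gradient f x - gradient f y with hδ
  have h1 := hc.add_inner_gradient_le hf x (y + L⁻¹ • δ)
  have h2 := le_add_inner_gradient_add_of_lipschitz hf hlip y (y + L⁻¹ • δ)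
  have h3 : ⟪gradient f x, δ⟫ - ⟪gradient f y, δ⟫ = ‖δ‖ ^ 2 := by
    rw [← inner_sub_left, ← hδ, real_inner_self_eq_norm_sq]
  rw [add_sub_cancel_left, norm_smul, mul_pow, Real.norm_of_nonneg (inv_pos.2 hL).le,
    inner_smul_right] at h2
  rw [add_sub_right_comm, inner_add_right, inner_smul_right] at h1
  have h4 : L⁻¹ * ‖δ‖ ^ 2 - L / 2 * (L⁻¹ ^ 2 * ‖δ‖ ^ 2) ≤
      f y - f x - ⟪gradient f x, y - x⟫ := by
    have h6 := congrArg (L⁻¹ * ·) h3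
    simp only [mul_sub] at h6
    linarith
  have h5 : L⁻¹ * ‖δ‖ ^ 2 - L / 2 * (L⁻¹ ^ 2 * ‖δ‖ ^ 2) = ‖δ‖ ^ 2 / (2 * L) := by
    field_simp
    ring
  rw [h5, div_le_iff₀ (by positivity)] at h4
  linarith

theorem gradient_const_mul_sum {ι : Type*} [Fintype ι] {f : ι → E → ℝ}
    (hf : ∀ i, Differentiable ℝ (f i)) (c : ℝ) (x : E) :
    gradient (fun y => c * ∑ i, f i y) x = c • ∑ i, gradient (f i) x := by
  refine HasGradientAt.gradient ?_
  rw [hasGradientAt_iff_hasFDerivAt]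
  have h := (HasFDerivAt.fun_sum (u := Finset.univ)
    fun i _ => ((hf i) x).hasFDerivAt).const_mul c
  refine h.congr_fderiv ?_
  simp [toDual_gradient]

end Smooth

theorem stepsize_quadratic_bound {L θ η V N : ℝ} (hL : 0 < L) (hθ : θ ∈ Set.Ioo (0 : ℝ) 1)
    (hη : 0 < η) (hηle : η ≤ 1 / (L * (1 + 1 / (1 - θ)))) (hV : 0 ≤ V) (hN : 0 ≤ N) :
    (L * η ^ 2 / 2 + η / 2) * (V + N) ≤ η * N + (1 - θ) * (V / L) := by
  obtain ⟨hθ0, hθ1⟩ := hθ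
  have hs : 0 < 1 - θ := by linarith
  have hpos : 0 < 1 / (1 - θ) := by positivity
  have hle : L * η ≤ 1 - θ := by
    have h : 1 / (L * (1 + 1 / (1 - θ))) ≤ 1 / (L * (1 / (1 - θ))) := by
      gcongr
      linarith
    calc L * η ≤ L * (1 / (L * (1 / (1 - θ)))) := by gcongr; exact hηle.trans h
      _ = 1 - θ := by field_simp
  have h1 : L * η ^ 2 / 2 + η / 2 ≤ η := by nlinarith
  have h2 : η ≤ (1 - θ) / L := by rw [le_div_iff₀ hL]; linarith
  calc (L * η ^ 2 / 2 + η / 2) * (V + N) ≤ η * (V + N) := by gcongr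
    _ = η * V + η * N := by ring
    _ ≤ (1 - θ) / L * V + η * N := by gcongr
    _ = _ := by ring

/-- Per-iteration inequality for the first stage of ANITA in the general convex case
(`μ = 0`, `α = θ`). -/
theorem anita_first_stage_inequality {d n : ℕ} (hn : 1 ≤ n)
    (f : Fin n → EuclideanSpace ℝ (Fin d) → ℝ) (L : ℝ) (hL : 0 < L)
    (hdiff : ∀ i, Differentiable ℝ (f i))
    (hconv : ∀ i, ConvexOn ℝ Set.univ (f i))
    (hlip : ∀ i x y, ‖gradient (f i) x - gradient (f i) y‖ ≤ L * ‖x - y‖)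
    (F : EuclideanSpace ℝ (Fin d) → ℝ)
    (hF : F = fun x => (1 / (n : ℝ)) * ∑ i, f i x)
    (xstar : EuclideanSpace ℝ (Fin d)) (hmin : ∀ y, F xstar ≤ F y)
    (x w : EuclideanSpace ℝ (Fin d)) (θ η : ℝ)
    (hθ : θ ∈ Set.Ioo (0 : ℝ) 1) (hη : 0 < η)
    (hηle : η ≤ 1 / (L * (1 + 1 / (1 - θ))))
    (u : EuclideanSpace ℝ (Fin d)) (hu : u = θ • x + (1 - θ) • w)
    (g xp b : Fin n → EuclideanSpace ℝ (Fin d))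
    (hg : ∀ i, g i = gradient (f i) u - gradient (f i) w + gradient F w)
    (hxp : ∀ i, xp i = x - (η / θ) • g i)
    (hb : ∀ i, b i = θ • xp i + (1 - θ) • w) :
    (1 / (n : ℝ)) * ∑ i, F (b i) ≤
      (1 - θ) * F w + θ * F xstar
        + (θ ^ 2 / (2 * η)) *
            (‖x - xstar‖ ^ 2 - (1 / (n : ℝ)) * ∑ i, ‖xp i - xstar‖ ^ 2)
        + (L * (1 - θ) * θ ^ 2 / 2) * ‖x - w‖ ^ 2 := by
  obtain ⟨hθ0, hθ1⟩ := hθ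
  have hn0 : (0 : ℝ) < n := by exact_mod_cast hn
  set c : ℝ := 1 / (n : ℝ) with hc
  have hc0 : 0 < c := by positivity
  have hcn : c * n = 1 := by rw [hc]; field_simp
  have hFx : ∀ y, F y = c * ∑ i, f i y := fun y => by rw [hF]
  have hG : ∀ y, gradient F y = c • ∑ i, gradient (f i) y := fun y => by
    rw [hF]; exact gradient_const_mul_sum hdiff c y
  have avg_le {a b : Fin n → ℝ} (h : ∀ i, a i ≤ b i) : c * ∑ i, a i ≤ c * ∑ i, b i :=
    mul_le_mul_of_nonneg_left (Finset.sum_le_sum fun i _ => h i) hc0.le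
  have avg_const (r : ℝ) : c * ∑ _i : Fin n, r = r := by
    simp [← mul_assoc, hcn]
  have avg_inner (p : Fin n → EuclideanSpace ℝ (Fin d)) (v : EuclideanSpace ℝ (Fin d)) :
      c * ∑ i, ⟪p i, v⟫ = ⟪c • ∑ i, p i, v⟫ := by
    rw [real_inner_smul_left, sum_inner]
  have avg_add (a b : Fin n → ℝ) : c * ∑ i, (a i + b i) = c * ∑ i, a i + c * ∑ i, b i := by
    rw [Finset.sum_add_distrib, mul_add]
  have avg_sub (a b : Fin n → ℝ) : c * ∑ i, (a i - b i) = c * ∑ i, a i - c * ∑ i, b i := by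
    rw [Finset.sum_sub_distrib, mul_sub]
  have avg_mul (r : ℝ) (a : Fin n → ℝ) : c * ∑ i, r * a i = r * (c * ∑ i, a i) := by
    rw [← Finset.mul_sum]; ring
  set G := gradient F u with hGu
  set K := gradient F w with hKw
  set Δ : Fin n → EuclideanSpace ℝ (Fin d) := fun i => gradient (f i) u - gradient (f i) w with hΔ
  have hΔavg : c • ∑ i, Δ i = G - K := by
    rw [hGu, hKw, hG, hG, ← smul_sub, ← Finset.sum_sub_distrib]
  have hgavg : c • ∑ i, g i = G := by
    have : ∑ i, g i = ∑ i, Δ i + (n : ℝ) • K := by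
      simp [hg, hΔ, Finset.sum_add_distrib, Nat.cast_smul_eq_nsmul]
    rw [this, smul_add, hΔavg, smul_smul, hcn, one_smul, sub_add_cancel]
  have descent (y : EuclideanSpace ℝ (Fin d)) :
      F y ≤ F u + ⟪G, y - u⟫ + L / 2 * ‖y - u‖ ^ 2 := by
    have h := avg_le fun i => le_add_inner_gradient_add_of_lipschitz (hdiff i) (hlip i) u y
    rwa [avg_add, avg_add, avg_const, avg_inner, ← hG, ← hFx, ← hFx] at h
  have convex (y : EuclideanSpace ℝ (Fin d)) : F u + ⟪G, y - u⟫ ≤ F y := by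
    have h := avg_le fun i => (hconv i).add_inner_gradient_le (hdiff i) u y
    rwa [avg_add, avg_inner, ← hG, ← hFx, ← hFx] at h
  have variance_le_bregman :
      c * ∑ i, ‖Δ i‖ ^ 2 ≤ 2 * L * (F w - F u - ⟪G, w - u⟫) := by
    have h := avg_le fun i => (hconv i).norm_gradient_sub_sq_le hL (hdiff i) (hlip i) u w
    rwa [avg_mul, avg_sub, avg_sub, avg_inner, ← hG, ← hFx, ← hFx] at h
  have variance_le_dist : c * ∑ i, ‖Δ i‖ ^ 2 ≤ L ^ 2 * ‖u - w‖ ^ 2 := by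
    rw [← avg_const (L ^ 2 * ‖u - w‖ ^ 2)]
    refine avg_le fun i => ?_
    rw [← mul_pow]
    exact pow_le_pow_left₀ (norm_nonneg _) (hlip i u w) 2
  have second_moment : c * ∑ i, ‖g i‖ ^ 2 ≤ c * ∑ i, ‖Δ i‖ ^ 2 + ‖G‖ ^ 2 := by
    have h : ∀ i, ‖g i‖ ^ 2 = ‖Δ i‖ ^ 2 + 2 * ⟪Δ i, K⟫ + ‖K‖ ^ 2 := fun i => by
      rw [hg, ← norm_add_sq_real]
    simp only [h]
    rw [avg_add, avg_add, avg_const, avg_mul, avg_inner, hΔavg, inner_sub_left,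
      real_inner_self_eq_norm_sq]
    have := norm_sub_sq_real G K
    nlinarith [sq_nonneg ‖G - K‖]
  have step : c * ∑ i, F (b i) ≤ F u - η * ‖G‖ ^ 2 + L * η ^ 2 / 2 * (c * ∑ i, ‖g i‖ ^ 2) := by
    have h : ∀ i, F (b i) ≤ F u - η * ⟪g i, G⟫ + L * η ^ 2 / 2 * ‖g i‖ ^ 2 := fun i => by
      have hbu : b i - u = -(η • g i) := by
        rw [hb, hxp, hu, smul_sub, smul_smul, mul_div_cancel₀ _ hθ0.ne']
        abel
      have h := descent (b i)
      rw [hbu, norm_neg, norm_smul, inner_neg_right, inner_smul_right, mul_pow,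
        Real.norm_of_nonneg hη.le, real_inner_comm] at h
      linarith
    have h := avg_le h
    rwa [avg_add, avg_sub, avg_const, avg_mul, avg_mul, avg_inner, hgavg,
      real_inner_self_eq_norm_sq] at h
  have three_point : (θ ^ 2 / (2 * η)) * (‖x - xstar‖ ^ 2 - c * ∑ i, ‖xp i - xstar‖ ^ 2) =
      θ * ⟪G, x - xstar⟫ - η / 2 * (c * ∑ i, ‖g i‖ ^ 2) := by
    have h : ∀ i, ‖xp i - xstar‖ ^ 2 =
        ‖x - xstar‖ ^ 2 - 2 * (η / θ) * ⟪g i, x - xstar⟫ + (η / θ) ^ 2 * ‖g i‖ ^ 2 := fun i => by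
      rw [hxp, sub_right_comm, norm_sub_sq_real, norm_smul, mul_pow, inner_smul_right,
        real_inner_comm, Real.norm_of_nonneg (by positivity)]
      ring
    simp only [h]
    rw [avg_add, avg_sub, avg_const, avg_mul, avg_mul, avg_inner, hgavg]
    field_simp
    ring
  have split : θ * ⟪G, x - xstar⟫ = -(θ * ⟪G, xstar - u⟫) - (1 - θ) * ⟪G, w - u⟫ := by
    simp only [← inner_smul_right, ← inner_neg_right, ← inner_sub_right]
    congr 1
    rw [hu]
    module
  have dist : ‖u - w‖ ^ 2 = θ ^ 2 * ‖x - w‖ ^ 2 := by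
    have : u - w = θ • (x - w) := by rw [hu]; module
    rw [this, norm_smul, mul_pow, Real.norm_of_nonneg hθ0.le]
  set V := c * ∑ i, ‖Δ i‖ ^ 2
  have hV0 : 0 ≤ V := mul_nonneg hc0.le (Finset.sum_nonneg fun i _ => sq_nonneg _)
  set M := c * ∑ i, ‖g i‖ ^ 2
  have hs : 0 < 1 - θ := by linarith
  have hx := mul_le_mul_of_nonneg_left (convex xstar) hθ0.le
  have hquad : (L * η ^ 2 / 2 + η / 2) * M ≤ η * ‖G‖ ^ 2 + (1 - θ) * (V / L) :=
    (mul_le_mul_of_nonneg_left second_moment (by positivity)).trans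
      (stepsize_quadratic_bound hL ⟨hθ0, hθ1⟩ hη hηle hV0 (sq_nonneg _))
  have hVL : V / L ≤ (F w - F u - ⟪G, w - u⟫) + L / 2 * ‖u - w‖ ^ 2 := by
    rw [div_le_iff₀ hL]
    linarith
  have hVs := mul_le_mul_of_nonneg_left hVL hs.le
  rw [dist] at hVs
  rw [three_point, split]
  linarith
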